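/- With B_n = ℤ[x₁,…,x_n]/(x₁⋯x_n − 1) and A_n ⊆ B_n the ℤ-subalgebra generated by the images of the elementary symmetric polynomials e₁,…,e_{n−1}, let A_n[x₁,…,x_k] denote the subalgebra of B_n generated by A_n together with the images of x₁,…,x_k. Then for each 0 ≤ k ≤ n−2, A_n[x₁,…,x_{k+1}] is a free module over A_n[x₁,…,x_k] with basis {1, x_{k+1}, x_{k+1}², …, x_{k+1}^{n−k−1}}. -/

import Mathlib

open MvPolynomial

/-- `BSU n` is the quotient ring `ℤ[x₁,…,xₙ]/(x₁⋯xₙ − 1)`. -/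
noncomputable abbrev BSU (n : ℕ) : Type :=
  MvPolynomial (Fin n) ℤ ⧸
    Ideal.span {(∏ i : Fin n, (X i : MvPolynomial (Fin n) ℤ)) - 1}

/-- The quotient map `ℤ[x₁,…,xₙ] → BSU n`. -/
noncomputable def BSUmk (n : ℕ) : MvPolynomial (Fin n) ℤ →+* BSU n :=
  Ideal.Quotient.mk _

/-- `ASUk n k` is the subalgebra `A_n[x₁,…,x_k]` of `B_n` generated by the images of the
elementary symmetric polynomials `e₁,…,e_{n-1}` together with the images of `x₁,…,x_k`.
For `k = 0` it is `A_n` itself. -/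
noncomputable def ASUk (n k : ℕ) : Subalgebra ℤ (BSU n) :=
  Algebra.adjoin ℤ
    (((fun m : ℕ => BSUmk n (esymm (Fin n) ℤ m)) '' Set.Icc 1 (n - 1)) ∪
      ((fun i : Fin n => BSUmk n (X i)) '' {i : Fin n | (i : ℕ) < k}))

theorem BSUmk_eq_zero_iff {n : ℕ} (p : MvPolynomial (Fin n) ℤ) :
    BSUmk n p = 0 ↔ (∏ i : Fin n, (X i : MvPolynomial (Fin n) ℤ)) - 1 ∣ p := by
  rw [BSUmk, Ideal.Quotient.eq_zero_iff_mem, Ideal.mem_span_singleton]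

theorem BSUmk_prod_X (n : ℕ) : BSUmk n (∏ i, X i) = 1 := by
  rw [← sub_eq_zero, ← map_one (BSUmk n), ← map_sub, BSUmk_eq_zero_iff]

theorem irreducible_prod_X_sub_one {n : ℕ} (hn : 1 ≤ n) :
    Irreducible ((∏ i : Fin n, (X i : MvPolynomial (Fin n) ℤ)) - 1) := by
  let i : Fin n := ⟨0, hn⟩
  rw [← Finset.prod_erase_mul _ _ (Finset.mem_univ i), sub_eq_add_neg]
  refine irreducible_mul_X_add _ _ i ?_ ?_ ?_ isUnit_one.neg.isRelPrime_right
  · exact Finset.prod_ne_zero_iff.mpr fun j _ => X_ne_zero j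
  · intro h
    obtain ⟨j, hj, hij⟩ := Finset.mem_biUnion.mp (vars_prod _ h)
    rw [vars_X, Finset.mem_singleton] at hij
    exact Finset.ne_of_mem_erase hj hij.symm
  · simp [vars_neg]

theorem BSU_isDomain {n : ℕ} (hn : 1 ≤ n) : IsDomain (BSU n) := by
  have h := irreducible_prod_X_sub_one hn
  have := (Ideal.span_singleton_prime h.ne_zero).mpr h.prime
  exact Ideal.Quotient.isDomain _

theorem BSUmk_X_injective (n : ℕ) :
    Function.Injective fun i : Fin n => BSUmk n (X i) := by
  intro i j hij
  by_contra hne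
  have hij : BSUmk n (X i - X j) = 0 := by rw [map_sub, sub_eq_zero]; exact hij
  rw [BSUmk_eq_zero_iff] at hij
  let v : Fin n → ℚ := Function.update (Function.update 1 i 2) j (1 / 2)
  have hi : v i = 2 := by simp [v, hne]
  have hj : v j = 1 / 2 := by simp [v]
  have hv : ∏ l, v l = 1 := by
    rw [← Finset.prod_subset (Finset.subset_univ {i, j}), Finset.prod_pair hne, hi, hj]
    · norm_num
    · intro l _ hl
      simp only [Finset.mem_insert, Finset.mem_singleton, not_or] at hl
      simp [v, hl.1, hl.2]
  have h := map_dvd (aeval v) hij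
  simp only [map_sub, map_prod, aeval_X, map_one, hv, sub_self, zero_dvd_iff, hi, hj] at h
  norm_num at h

/-- The automorphism of `BSU n` permuting the variables, as an algebra endomorphism. -/
noncomputable def BSUperm {n : ℕ} (σ : Equiv.Perm (Fin n)) : BSU n →ₐ[ℤ] BSU n :=
  Ideal.quotientMapₐ _ (rename σ) <| by
    rw [Ideal.span_singleton_le_iff_mem, Ideal.mem_comap, Ideal.mem_span_singleton]
    simp [map_prod, Equiv.prod_comp σ fun i => (X i : MvPolynomial (Fin n) ℤ)]

theorem BSUperm_mk {n : ℕ} (σ : Equiv.Perm (Fin n)) (p : MvPolynomial (Fin n) ℤ) :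
    BSUperm σ (BSUmk n p) = BSUmk n (rename σ p) :=
  rfl

theorem BSUperm_eq_self_of_mem_ASUk {n k : ℕ} {σ : Equiv.Perm (Fin n)}
    (hσ : ∀ i : Fin n, (i : ℕ) < k → σ i = i) {b : BSU n} (hb : b ∈ ASUk n k) :
    BSUperm σ b = b := by
  suffices ASUk n k ≤ AlgHom.equalizer (BSUperm σ) (AlgHom.id ℤ (BSU n)) from this hb
  refine Algebra.adjoin_le ?_
  rintro _ (⟨m, -, rfl⟩ | ⟨i, hi, rfl⟩)
  · simp [BSUperm_mk, rename_esymm]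
  · simp [BSUperm_mk, hσ i hi]

theorem BSUmk_esymm_mem_ASUk {n k m : ℕ} (hm : m ≤ n) :
    BSUmk n (esymm (Fin n) ℤ m) ∈ ASUk n k := by
  rcases Nat.eq_zero_or_pos m with rfl | hpos
  · simp [one_mem]
  rcases hm.eq_or_lt with rfl | hlt
  · have : esymm (Fin m) ℤ m = ∏ i, X i := by
      have h := Finset.powersetCard_self (Finset.univ : Finset (Fin m))
      rw [Finset.card_fin] at h
      rw [esymm, h, Finset.sum_singleton]
    rw [this, BSUmk_prod_X]
    exact one_mem _
  · exact Algebra.subset_adjoin (Or.inl ⟨m, ⟨hpos, by omega⟩, rfl⟩)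

theorem BSUmk_X_mem_ASUk {n k : ℕ} {i : Fin n} (hi : (i : ℕ) < k) :
    BSUmk n (X i) ∈ ASUk n k :=
  Algebra.subset_adjoin (Or.inr ⟨i, hi, rfl⟩)

theorem exists_map_eq_prod_X_sub_C (n k : ℕ) :
    ∃ F : Polynomial (ASUk n k), F.map (algebraMap (ASUk n k) (BSU n)) =
      ∏ i : Fin n, (Polynomial.X - Polynomial.C (BSUmk n (X i))) := by
  let s : Multiset (BSU n) := Finset.univ.val.map fun i : Fin n => BSUmk n (X i)
  have hs (m : ℕ) : s.esymm m = BSUmk n (esymm (Fin n) ℤ m) := by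
    have h : aeval (fun i : Fin n => BSUmk n (X i)) = Ideal.Quotient.mkₐ ℤ _ :=
      (aeval_unique (Ideal.Quotient.mkₐ ℤ _)).symm
    rw [← aeval_esymm_eq_multiset_esymm (Fin n) ℤ, h]
    rfl
  have hcard : s.card = n := by simp [s]
  have hprod : ∏ i : Fin n, (Polynomial.X - Polynomial.C (BSUmk n (X i))) =
      (s.map fun t => Polynomial.X - Polynomial.C t).prod := by
    rw [Multiset.map_map]
    rfl
  rw [hprod, Multiset.prod_X_sub_X_eq_sum_esymm, hcard]
  simp_rw [hs]
  refine ⟨∑ m : Fin (n + 1), (-1) ^ (m : ℕ) *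
    (Polynomial.C ⟨_, BSUmk_esymm_mem_ASUk (Nat.lt_succ_iff.mp m.2)⟩ *
      Polynomial.X ^ (n - (m : ℕ))), ?_⟩
  rw [Finset.sum_range, Polynomial.map_sum]
  refine Finset.sum_congr rfl fun m _ => ?_
  simp only [Polynomial.map_mul, Polynomial.map_pow, Polynomial.map_neg, Polynomial.map_one,
    Polynomial.map_C, Polynomial.map_X]
  rfl

theorem exists_monic_map_eq_prod_X_sub_C {n k : ℕ} (hn : 1 ≤ n) :
    ∃ P : Polynomial (ASUk n k), P.Monic ∧ P.natDegree = n - k ∧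
      P.map (algebraMap (ASUk n k) (BSU n)) =
        ∏ i with ¬ (i : Fin n).val < k, (Polynomial.X - Polynomial.C (BSUmk n (X i))) := by
  obtain ⟨F, hF⟩ := exists_map_eq_prod_X_sub_C n k
  let D : Polynomial (ASUk n k) := ∏ i : {i : Fin n // (i : ℕ) < k},
    (Polynomial.X - Polynomial.C ⟨_, BSUmk_X_mem_ASUk i.2⟩)
  have hD : D.Monic := Polynomial.monic_prod_of_monic _ _ fun i _ => Polynomial.monic_X_sub_C _
  have hDmap : D.map (algebraMap (ASUk n k) (BSU n)) =
      ∏ i with (i : Fin n).val < k, (Polynomial.X - Polynomial.C (BSUmk n (X i))) := by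
    rw [Polynomial.map_prod, Finset.prod_subtype (p := fun i : Fin n => (i : ℕ) < k)
      (Finset.univ.filter fun i : Fin n => (i : ℕ) < k) (by simp)
      fun i => Polynomial.X - Polynomial.C (BSUmk n (X i))]
    refine Finset.prod_congr rfl fun i _ => ?_
    rw [Polynomial.map_sub, Polynomial.map_X, Polynomial.map_C]
    rfl
  have hP : (F /ₘ D).map (algebraMap (ASUk n k) (BSU n)) =
      ∏ i with ¬ (i : Fin n).val < k, (Polynomial.X - Polynomial.C (BSUmk n (X i))) := by
    rw [Polynomial.map_divByMonic _ hD, hF, hDmap,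
      ← Finset.prod_filter_mul_prod_filter_not Finset.univ (fun i : Fin n => (i : ℕ) < k)
        fun i => Polynomial.X - Polynomial.C (BSUmk n (X i)),
      Polynomial.mul_divByMonic_cancel_left]
    exact Polynomial.monic_prod_of_monic _ _ fun i _ => Polynomial.monic_X_sub_C _
  have hinj : Function.Injective (algebraMap (ASUk n k) (BSU n)) := Subtype.val_injective
  have := BSU_isDomain hn
  refine ⟨F /ₘ D, ?_, ?_, hP⟩
  · refine Polynomial.monic_of_injective hinj ?_
    rw [hP]
    exact Polynomial.monic_prod_of_monic _ _ fun i _ => Polynomial.monic_X_sub_C _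
  · rw [← Polynomial.natDegree_map_eq_of_injective hinj, hP,
      Polynomial.natDegree_finsetProd_X_sub_C_eq_card]
    have h := Finset.card_filter_add_card_filter_not (s := Finset.univ)
      fun i : Fin n => (i : ℕ) < k
    rw [Fin.card_filter_val_lt, Finset.card_fin] at h
    omega

theorem ASUk_succ {n k : ℕ} (hk : k < n) :
    ASUk n (k + 1) =
      (Algebra.adjoin (ASUk n k) {BSUmk n (X (⟨k, hk⟩ : Fin n))}).restrictScalars ℤ := by
  unfold ASUk
  rw [← Algebra.adjoin_union_eq_adjoin_adjoin, Set.union_assoc]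
  congr 2
  ext b
  simp only [Set.mem_image, Set.mem_union, Set.mem_singleton_iff, Set.mem_ofPred_eq,
    Nat.lt_succ_iff_lt_or_eq]
  constructor
  · rintro ⟨i, hi | rfl, rfl⟩
    · exact Or.inl ⟨i, hi, rfl⟩
    · exact Or.inr rfl
  · rintro (⟨i, hi, rfl⟩ | rfl)
    · exact ⟨i, Or.inl hi, rfl⟩
    · exact ⟨⟨k, hk⟩, Or.inr rfl, rfl⟩

theorem span_pow_eq_ASUk_succ {n k : ℕ} (hk : k < n) :
    (Submodule.span (ASUk n k)
        (Set.range fun j : Fin (n - k) => BSUmk n (X (⟨k, hk⟩ : Fin n) ^ (j : ℕ))) :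
          Set (BSU n)) = ASUk n (k + 1) := by
  obtain ⟨P, hP, hdeg, hmap⟩ := exists_monic_map_eq_prod_X_sub_C (n := n) (k := k) (by omega)
  have hroot : Polynomial.aeval (BSUmk n (X (⟨k, hk⟩ : Fin n))) P = 0 := by
    rw [← Polynomial.eval_map_algebraMap, hmap, Polynomial.eval_prod]
    exact Finset.prod_eq_zero (i := ⟨k, hk⟩) (by simp) (by simp)
  have h := Submodule.span_range_natDegree_eq_adjoin hP hroot
  rw [ASUk_succ hk, Subalgebra.coe_restrictScalars, ← Subalgebra.coe_toSubmodule, ← h, hdeg]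
  congr 2
  ext b
  simp [Fin.exists_iff]

theorem linearIndependent_BSUmk_X_pow {n k : ℕ} (hk : k < n) :
    LinearIndependent (ASUk n k)
      (fun j : Fin (n - k) => BSUmk n (X (⟨k, hk⟩ : Fin n) ^ (j : ℕ))) := by
  have := BSU_isDomain (n := n) (by omega)
  rw [Fintype.linearIndependent_iff]
  intro g hg
  let f : Fin (n - k) → Fin n := fun j => ⟨k + j, by omega⟩
  have hf : Function.Injective f := fun a b hab => by
    simpa [f, Fin.ext_iff] using hab
  have key := Matrix.eq_zero_of_forall_index_sum_mul_pow_eq_zero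
    (f := fun j => BSUmk n (X (f j))) (v := fun j => (g j : BSU n))
    ((BSUmk_X_injective n).comp hf) fun j => by
      have h := congrArg (BSUperm (Equiv.swap ⟨k, hk⟩ (f j))) hg
      rw [map_sum, map_zero] at h
      rw [← h]
      refine Finset.sum_congr rfl fun i _ => ?_
      rw [Subalgebra.smul_def, smul_eq_mul, map_mul, BSUperm_mk,
        BSUperm_eq_self_of_mem_ASUk _ (g i).2]
      · simp
      · intro l hl
        refine Equiv.swap_apply_of_ne_of_ne ?_ ?_ <;> rintro rfl <;> simp [f] at hl
  exact fun j => Subtype.ext (congrFun key j)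

/-- For `0 ≤ k ≤ n − 2`, `A_n[x₁,…,x_{k+1}]` is a free module over `A_n[x₁,…,x_k]` with
basis `{1, x_{k+1}, …, x_{k+1}^{n−k−1}}`: the powers `x_{k+1}^j`, `0 ≤ j ≤ n−k−1`, are
linearly independent over `A_n[x₁,…,x_k]` and their span over it is `A_n[x₁,…,x_{k+1}]`. -/
theorem stmt9 (n k : ℕ) (hn : 1 ≤ n) (hk : k ≤ n - 2) :
    LinearIndependent (ASUk n k)
        (fun j : Fin (n - k) => BSUmk n (X (⟨k, by omega⟩ : Fin n) ^ (j : ℕ))) ∧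
      (Submodule.span (ASUk n k)
          (Set.range fun j : Fin (n - k) =>
            BSUmk n (X (⟨k, by omega⟩ : Fin n) ^ (j : ℕ))) : Set (BSU n)) =
        (ASUk n (k + 1) : Set (BSU n)) := by
  exact ⟨linearIndependent_BSUmk_X_pow (by omega), span_pow_eq_ASUk_succ (by omega)⟩
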